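/- arXiv:1411.1490 — 6 statements merged into one kernel-verified Lean document; each statement's English description precedes it below -/
import Mathlib

section
/- Let a₁, …, a_{k−1}, b, b̃ be vectors in Euclidean space ℝⁿ with b and b̃ nonzero. Set U = span{a₁, …, a_{k−1}}, V = span{a₁, …, a_{k−1}, b}, and Ṽ = span{a₁, …, a_{k−1}, b̃}, and assume U ≠ {0}. Then θ(V, Ṽ) · θ(b̃, U) ≤ (π/2) · θ(b̃, b). -/
open InnerProductGeometry

/-- The angle between a vector `u` and a linear subspace `V`:
`θ(u,V) := inf{θ(u,v) : v ∈ V, v ≠ 0}`. -/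
noncomputable def angleToSub {n : ℕ} (u : EuclideanSpace ℝ (Fin n))
    (V : Submodule ℝ (EuclideanSpace ℝ (Fin n))) : ℝ :=
  sInf {θ : ℝ | ∃ v ∈ V, v ≠ 0 ∧ θ = InnerProductGeometry.angle u v}

/-- The (one-sided) angle between linear subspaces `U` and `V`:
`θ(U,V) := sup{θ(u,V) : u ∈ U, u ≠ 0}`. -/
noncomputable def subAngle {n : ℕ} (U V : Submodule ℝ (EuclideanSpace ℝ (Fin n))) : ℝ :=
  sSup {θ : ℝ | ∃ u ∈ U, u ≠ 0 ∧ θ = angleToSub u V}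

lemma sin_mul_mul_cos_le {s x : ℝ} (hs0 : 0 ≤ s) (hs1 : s ≤ 1) (hx0 : 0 ≤ x)
    (hx : x ≤ Real.pi / 2) :
    Real.sin (s * x) * Real.cos x ≤ s * Real.cos (s * x) * Real.sin x := by
  have hd : ∀ y : ℝ, HasDerivAt
      (fun y => s * Real.cos (s * y) * Real.sin y - Real.sin (s * y) * Real.cos y)
      ((1 - s ^ 2) * (Real.sin (s * y) * Real.sin y)) y := by
    intro y
    have hl : HasDerivAt (fun y : ℝ => s * y) s y := by
      simpa using (hasDerivAt_id y).const_mul s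
    refine (((hl.cos.const_mul s).mul (Real.hasDerivAt_sin y)).sub
      (hl.sin.mul (Real.hasDerivAt_cos y))).congr_deriv ?_
    ring
  have hmono : MonotoneOn
      (fun y => s * Real.cos (s * y) * Real.sin y - Real.sin (s * y) * Real.cos y)
      (Set.Icc 0 (Real.pi / 2)) := by
    refine monotoneOn_of_hasDerivWithinAt_nonneg (convex_Icc _ _)
      (fun y _ => (hd y).continuousAt.continuousWithinAt)
      (fun y _ => (hd y).hasDerivWithinAt) fun y hy => ?_
    rw [interior_Icc] at hy
    have hsy : s * y ≤ y := mul_le_of_le_one_left hy.1.le hs1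
    have h1 : 0 ≤ Real.sin (s * y) :=
      Real.sin_nonneg_of_nonneg_of_le_pi (mul_nonneg hs0 hy.1.le)
        (by linarith [hy.2, Real.pi_pos])
    have h2 : 0 ≤ Real.sin y :=
      Real.sin_nonneg_of_nonneg_of_le_pi hy.1.le (by linarith [hy.2, Real.pi_pos])
    exact mul_nonneg (by nlinarith) (mul_nonneg h1 h2)
  have := hmono ⟨le_rfl, by positivity⟩ ⟨hx0, hx⟩ hx0
  simp only [mul_zero, Real.sin_zero, zero_mul, sub_zero] at this
  linarith

lemma sin_mul_le_sin_mul_sin {s x : ℝ} (hs0 : 0 ≤ s) (hs1 : s ≤ 1) (hx0 : 0 ≤ x)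
    (hx : x ≤ Real.pi / 2) :
    Real.sin (s * x) ≤ Real.sin (s * (Real.pi / 2)) * Real.sin x := by
  rcases hx0.eq_or_lt with rfl | hx0
  · simp
  have hsin : ∀ y ∈ Set.Icc x (Real.pi / 2), 0 < Real.sin y := fun y hy =>
    Real.sin_pos_of_pos_of_lt_pi (hx0.trans_le hy.1) (by linarith [hy.2, Real.pi_pos])
  have hd : ∀ y ∈ Set.Icc x (Real.pi / 2), HasDerivAt
      (fun y => Real.sin (s * y) / Real.sin y)
      ((s * Real.cos (s * y) * Real.sin y - Real.sin (s * y) * Real.cos y) / Real.sin y ^ 2)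
      y := by
    intro y hy
    have hl : HasDerivAt (fun y : ℝ => s * y) s y := by
      simpa using (hasDerivAt_id y).const_mul s
    refine (hl.sin.div (Real.hasDerivAt_sin y) (hsin y hy).ne').congr_deriv ?_
    ring
  have hmono : MonotoneOn (fun y => Real.sin (s * y) / Real.sin y)
      (Set.Icc x (Real.pi / 2)) := by
    refine monotoneOn_of_hasDerivWithinAt_nonneg (convex_Icc _ _)
      (fun y hy => (hd y hy).continuousAt.continuousWithinAt)
      (fun y hy => (hd y (interior_subset hy)).hasDerivWithinAt) fun y hy => ?_
    have hy' := interior_subset hy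
    exact div_nonneg (sub_nonneg.2 <|
      sin_mul_mul_cos_le hs0 hs1 (hx0.le.trans hy'.1) hy'.2) (sq_nonneg _)
  have := hmono ⟨le_rfl, hx⟩ ⟨hx, le_rfl⟩ hx
  simp only [Real.sin_pi_div_two, div_one] at this
  rwa [div_le_iff₀ (hsin x ⟨le_rfl, hx⟩)] at this

/-- If `sin x * sin y ≤ sin z` with `x, y ∈ [0, π/2]` and `z ≥ 0`, then `x * y ≤ (π/2) * z`. -/
lemma mul_le_pi_div_two_mul_of_sin_mul_sin_le {x y z : ℝ} (hx0 : 0 ≤ x)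
    (hx : x ≤ Real.pi / 2) (hy0 : 0 ≤ y) (hy : y ≤ Real.pi / 2) (hz0 : 0 ≤ z)
    (h : Real.sin x * Real.sin y ≤ Real.sin z) :
    x * y ≤ Real.pi / 2 * z := by
  have hpi : 0 < Real.pi / 2 := by positivity
  have hs0 : 0 ≤ y / (Real.pi / 2) := by positivity
  have hs1 : y / (Real.pi / 2) ≤ 1 := (div_le_one hpi).2 hy
  have h1 := sin_mul_le_sin_mul_sin hs0 hs1 hx0 hx
  rw [div_mul_cancel₀ _ hpi.ne'] at h1
  have hle : y / (Real.pi / 2) * x ≤ z := by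
    by_contra! hlt
    refine absurd (Real.sin_lt_sin_of_lt_of_le_pi_div_two (by linarith) ?_ hlt) ?_
    · exact (mul_le_of_le_one_left hx0 hs1).trans hx
    · linarith
  rw [div_mul_eq_mul_div, div_le_iff₀ hpi] at hle
  linarith

section InnerProductSpace

variable {E : Type*} [NormedAddCommGroup E] [InnerProductSpace ℝ E]

lemma sin_angle_mul_norm_le_norm_sub (u w : E) :
    Real.sin (angle u w) * ‖u‖ ≤ ‖u - w‖ := by
  refine abs_le_of_sq_le_sq' ?_ (norm_nonneg _) |>.2
  have h1 := cos_angle_mul_norm_mul_norm u w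
  have h2 := norm_sub_sq_real u w
  have h3 := Real.sin_sq_add_cos_sq (angle u w)
  rw [← h1] at h2
  have h4 : (Real.sin (angle u w) * ‖u‖) ^ 2
      = ‖u‖ ^ 2 - (Real.cos (angle u w) * ‖u‖) ^ 2 := by
    rw [mul_pow, mul_pow, eq_sub_of_add_eq h3]; ring
  rw [h2, h4]
  nlinarith [sq_nonneg (Real.cos (angle u w) * ‖u‖ - ‖w‖)]

lemma exists_norm_sub_smul_eq_sin_angle_mul_norm (u v : E) (hv : v ≠ 0) :
    ∃ r : ℝ, ‖u - r • v‖ = Real.sin (angle u v) * ‖u‖ := by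
  have hvn : ‖v‖ ≠ 0 := norm_ne_zero_iff.2 hv
  refine ⟨Real.cos (angle u v) * ‖u‖ / ‖v‖, ?_⟩
  rw [← sq_eq_sq₀ (norm_nonneg _) (mul_nonneg (sin_angle_nonneg u v) (norm_nonneg u)),
    norm_sub_sq_real, inner_smul_right, norm_smul, ← cos_angle_mul_norm_mul_norm u v,
    Real.norm_eq_abs, mul_pow, sq_abs, mul_pow, Real.sin_sq]
  field_simp
  ring

/-- If the distance from `x` to every multiple of `y` is at least `c * ‖x‖`, then the distance
from `y` to every multiple of `x` is at least `c * ‖y‖`. -/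
lemma mul_norm_le_norm_sub_smul_swap {c : ℝ} (hc : 0 ≤ c) {x y : E} (hx : x ≠ 0)
    (h : ∀ s : ℝ, c * ‖x‖ ≤ ‖x - s • y‖) (r : ℝ) : c * ‖y‖ ≤ ‖y - r • x‖ := by
  rcases eq_or_ne y 0 with rfl | hy
  · simp
  have hxn : 0 < ‖x‖ := norm_pos_iff.2 hx
  have hyn : 0 < ‖y‖ := norm_pos_iff.2 hy
  have h1 : (c * ‖x‖) ^ 2 * ‖y‖ ^ 2 ≤ ‖x‖ ^ 2 * ‖y‖ ^ 2 - inner ℝ x y ^ 2 := by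
    have h2 := pow_le_pow_left₀ (by positivity) (h (inner ℝ x y / ‖y‖ ^ 2)) 2
    rw [norm_sub_sq_real, inner_smul_right, norm_smul, Real.norm_eq_abs, mul_pow |_| _, sq_abs] at h2
    calc _ ≤ _ := mul_le_mul_of_nonneg_right h2 (sq_nonneg ‖y‖)
      _ = _ := by field_simp; ring
  have h3 : ‖y - r • x‖ ^ 2 = ‖y‖ ^ 2 - 2 * (r * inner ℝ x y) + r ^ 2 * ‖x‖ ^ 2 := by
    rw [norm_sub_sq_real, inner_smul_right, norm_smul, Real.norm_eq_abs, mul_pow, sq_abs,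
      real_inner_comm]
  refine abs_le_of_sq_le_sq' ?_ (norm_nonneg _) |>.2
  refine le_of_mul_le_mul_left ?_ (pow_pos hxn 2)
  rw [h3]
  nlinarith [sq_nonneg (r * ‖x‖ ^ 2 - inner ℝ x y)]

end InnerProductSpace

section AngleToSub

variable {n : ℕ} (u : EuclideanSpace ℝ (Fin n)) {W : Submodule ℝ (EuclideanSpace ℝ (Fin n))}

lemma angleToSub_nonneg (W : Submodule ℝ (EuclideanSpace ℝ (Fin n))) : 0 ≤ angleToSub u W := by
  refine Real.sInf_nonneg ?_
  rintro _ ⟨v, -, -, rfl⟩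
  exact angle_nonneg u v

lemma angleToSub_le_angle {v : EuclideanSpace ℝ (Fin n)} (hv : v ∈ W) (hv0 : v ≠ 0) :
    angleToSub u W ≤ angle u v := by
  refine csInf_le ⟨0, ?_⟩ ⟨v, hv, hv0, rfl⟩
  rintro _ ⟨v, -, -, rfl⟩
  exact angle_nonneg u v

lemma angleToSub_le_pi_div_two (hW : W ≠ ⊥) : angleToSub u W ≤ Real.pi / 2 := by
  obtain ⟨v, hv, hv0⟩ := Submodule.exists_mem_ne_zero_of_ne_bot hW
  have h1 := angleToSub_le_angle u hv hv0
  have h2 := angleToSub_le_angle u (W.neg_mem hv) (neg_ne_zero.2 hv0)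
  rw [angle_neg_right] at h2
  linarith

lemma sin_angleToSub_mul_norm_le (hW : W ≠ ⊥) {w : EuclideanSpace ℝ (Fin n)} (hw : w ∈ W) :
    Real.sin (angleToSub u W) * ‖u‖ ≤ ‖u - w‖ := by
  rcases eq_or_ne w 0 with rfl | hw0
  · simpa using mul_le_of_le_one_left (norm_nonneg u) (Real.sin_le_one _)
  refine le_trans ?_ (sin_angle_mul_norm_le_norm_sub u w)
  refine mul_le_mul_of_nonneg_right ?_ (norm_nonneg u)
  have h0 := angleToSub_nonneg u W
  have hpi := angleToSub_le_pi_div_two u hW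
  have h1 := angleToSub_le_angle u hw hw0
  rcases le_total (angle u w) (Real.pi / 2) with h | h
  · exact Real.sin_le_sin_of_le_of_le_pi_div_two (by linarith) h h1
  · have h2 := angleToSub_le_angle u (W.neg_mem hw) (neg_ne_zero.2 hw0)
    rw [angle_neg_right] at h2
    rw [← Real.sin_pi_sub (angle u w)]
    exact Real.sin_le_sin_of_le_of_le_pi_div_two (by linarith) (by linarith) h2

lemma angleToSub_eq_zero_of_mem (hu : u ∈ W) (hu0 : u ≠ 0) : angleToSub u W = 0 :=
  le_antisymm ((angleToSub_le_angle u hu hu0).trans_eq (angle_self hu0)) (angleToSub_nonneg u W)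

/-- For `v = t • b + z` outside `U` with `z ∈ U`, and `W` containing `U` and `b'`,
`sin θ(v, W) * sin θ(b', U) ≤ sin θ(b', b)`. -/
lemma sin_angleToSub_mul_sin_angleToSub_le {U : Submodule ℝ (EuclideanSpace ℝ (Fin n))}
    {b b' z : EuclideanSpace ℝ (Fin n)} {t : ℝ} (hU : U ≠ ⊥) (hb : b ≠ 0) (hb' : b' ≠ 0)
    (hz : z ∈ U) (hv : t • b + z ∉ U) (hUW : U ≤ W) (hbW : b' ∈ W) :
    Real.sin (angleToSub (t • b + z) W) * Real.sin (angleToSub b' U)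
      ≤ Real.sin (angle b' b) := by
  have hW : W ≠ ⊥ := fun h => hU (le_bot_iff.1 (h ▸ hUW))
  set v := t • b + z with hv_def
  set Q := Uᗮ.starProjection with hQ
  have hsub : ∀ w, w - Q w ∈ U := fun w => by
    rw [hQ, Submodule.starProjection_orthogonal_val, sub_sub_cancel]
    exact U.starProjection_apply_mem w
  have hQz : Q z = 0 := by
    rw [hQ, Submodule.starProjection_orthogonal_val, Submodule.starProjection_eq_self_iff.2 hz,
      sub_self]
  have hQv : Q v = t • Q b := by rw [hv_def, map_add, map_smul, hQz, add_zero]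
  have hQv0 : Q v ≠ 0 := fun h => hv (by simpa [h] using hsub v)
  have ht : t ≠ 0 := fun h => hQv0 (by rw [hQv, h, zero_smul])
  have hQb0 : Q b ≠ 0 := fun h => hQv0 (by rw [hQv, h, smul_zero])
  have hφ : 0 ≤ Real.sin (angleToSub v W) :=
    Real.sin_nonneg_of_nonneg_of_le_pi (angleToSub_nonneg v W)
      (by linarith [angleToSub_le_pi_div_two v hW, Real.pi_pos])
  have hdist : ∀ s : ℝ, Real.sin (angleToSub v W) * ‖Q v‖ ≤ ‖Q v - s • Q b'‖ := by
    intro s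
    have hmem : (v - Q v) + s • (b' - (b' - Q b')) ∈ W :=
      W.add_mem (hUW (hsub v)) (W.smul_mem s (W.sub_mem hbW (hUW (hsub b'))))
    calc Real.sin (angleToSub v W) * ‖Q v‖ ≤ Real.sin (angleToSub v W) * ‖v‖ :=
          mul_le_mul_of_nonneg_left (Uᗮ.norm_starProjection_apply_le v) hφ
      _ ≤ _ := sin_angleToSub_mul_norm_le v hW hmem
      _ = _ := by congr 1; module
  obtain ⟨r, hr⟩ := exists_norm_sub_smul_eq_sin_angle_mul_norm b' b hb
  have h1 := mul_norm_le_norm_sub_smul_swap hφ hQv0 hdist (r / t)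
  rw [hQv, smul_smul, div_mul_cancel₀ _ ht, ← map_smul, ← map_sub] at h1
  have h2 : Real.sin (angleToSub b' U) * ‖b'‖ ≤ ‖Q b'‖ := by
    simpa using sin_angleToSub_mul_norm_le b' hU (hsub b')
  refine le_of_mul_le_mul_right ?_ (norm_pos_iff.2 hb')
  calc _ = Real.sin (angleToSub v W) * (Real.sin (angleToSub b' U) * ‖b'‖) := mul_assoc _ _ _
    _ ≤ Real.sin (angleToSub v W) * ‖Q b'‖ := mul_le_mul_of_nonneg_left h2 hφ
    _ ≤ ‖Q (b' - r • b)‖ := h1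
    _ ≤ ‖b' - r • b‖ := Uᗮ.norm_starProjection_apply_le _
    _ = _ := hr

end AngleToSub

/-- Lemma 2 (one-vector subspace angle lemma): with
`U = span{a₁,…,a_{k−1}}`, `V = span{a₁,…,a_{k−1},b}`, `Ṽ = span{a₁,…,a_{k−1},b̃}`,
`b, b̃ ≠ 0`, `U ≠ {0}`, one has `θ(V,Ṽ) · θ(b̃,U) ≤ (π/2) · θ(b̃,b)`. -/
theorem one_vector_subspace_angle {n K : ℕ} (a : Fin K → EuclideanSpace ℝ (Fin n))
    (b btil : EuclideanSpace ℝ (Fin n)) (hb : b ≠ 0) (hbt : btil ≠ 0)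
    (hU : Submodule.span ℝ (Set.range a) ≠ ⊥) :
    subAngle (Submodule.span ℝ (insert b (Set.range a)))
        (Submodule.span ℝ (insert btil (Set.range a))) *
      angleToSub btil (Submodule.span ℝ (Set.range a))
      ≤ (Real.pi / 2) * InnerProductGeometry.angle btil b := by
  set U := Submodule.span ℝ (Set.range a)
  set W := Submodule.span ℝ (insert btil (Set.range a))
  have hUW : U ≤ W := Submodule.span_mono (Set.subset_insert _ _)
  have hbW : btil ∈ W := Submodule.subset_span (Set.mem_insert _ _)
  have hW : W ≠ ⊥ := fun h => hU (le_bot_iff.1 (h ▸ hUW))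
  have hα0 := angleToSub_nonneg btil U
  have hα := angleToSub_le_pi_div_two btil hU
  have hβ0 := angle_nonneg btil b
  rcases hα0.eq_or_lt with h0 | hαpos
  · rw [← h0, mul_zero]
    positivity
  rw [← le_div_iff₀ hαpos]
  refine Real.sSup_le ?_ (by positivity)
  rintro _ ⟨v, hv, hv0, rfl⟩
  rw [le_div_iff₀ hαpos]
  by_cases hvU : v ∈ U
  · rw [angleToSub_eq_zero_of_mem v (hUW hvU) hv0, zero_mul]
    positivity
  have hφ0 := angleToSub_nonneg v W
  have hφ := angleToSub_le_pi_div_two v hW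
  refine mul_le_pi_div_two_mul_of_sin_mul_sin_le hφ0 hφ hα0 hα hβ0 ?_
  obtain ⟨t, z, hz, rfl⟩ := Submodule.mem_span_insert.1 hv
  exact sin_angleToSub_mul_sin_angleToSub_le hU hb hbt hz hvU hUW hbW
end

section
/- For all real numbers α, β with 0 ≤ α ≤ π/2 and 0 ≤ β ≤ π/2, one has α·β ≤ (π/2)·arcsin(sin α · sin β). -/
/-- For `0 ≤ s ≤ 1`, the function `x ↦ arcsin (sin x * s)` is concave on `[0, π/2]`. -/
theorem concaveOn_arcsin_sin_mul {s : ℝ} (hs₀ : 0 ≤ s) (hs₁ : s ≤ 1) :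
    ConcaveOn ℝ (Set.Icc 0 (Real.pi / 2)) fun x => Real.arcsin (Real.sin x * s) := by
  have sin_mem : ∀ x ∈ Set.Ioo 0 (Real.pi / 2), 0 ≤ Real.sin x * s ∧ Real.sin x * s < 1 := by
    intro x hx
    have h₀ : 0 ≤ Real.sin x :=
      Real.sin_nonneg_of_nonneg_of_le_pi hx.1.le (by linarith [hx.2, Real.pi_pos])
    have h₁ : Real.sin x < 1 := by
      rw [← Real.sin_pi_div_two]
      exact Real.sin_lt_sin_of_lt_of_le_pi_div_two (by linarith [hx.1, Real.pi_pos]) le_rfl hx.2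
    exact ⟨mul_nonneg h₀ hs₀, (mul_le_of_le_one_right h₀ hs₁).trans_lt h₁⟩
  have hasDeriv : ∀ x ∈ Set.Ioo 0 (Real.pi / 2),
      HasDerivAt (fun x => Real.arcsin (Real.sin x * s))
        (1 / √(1 - (Real.sin x * s) ^ 2) * (Real.cos x * s)) x := by
    intro x hx
    obtain ⟨h₀, h₁⟩ := sin_mem x hx
    exact (Real.hasDerivAt_arcsin (by linarith) h₁.ne).comp x
      ((Real.hasDerivAt_sin x).mul_const s)
  refine AntitoneOn.concaveOn_of_deriv (convex_Icc _ _)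
    (Real.continuous_arcsin.comp (Real.continuous_sin.mul continuous_const)).continuousOn ?_ ?_
  · rw [interior_Icc]
    exact fun x hx => (hasDeriv x hx).differentiableAt.differentiableWithinAt
  · rw [interior_Icc]
    intro a ha b hb hab
    rw [(hasDeriv a ha).deriv, (hasDeriv b hb).deriv]
    obtain ⟨ha₀, ha₁⟩ := sin_mem a ha
    obtain ⟨hb₀, hb₁⟩ := sin_mem b hb
    have hA : 0 < 1 - (Real.sin a * s) ^ 2 := by nlinarith
    have hB : 0 < 1 - (Real.sin b * s) ^ 2 := by nlinarith
    have hcb : 0 ≤ Real.cos b :=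
      Real.cos_nonneg_of_neg_pi_div_two_le_of_le (by linarith [hb.1, Real.pi_pos]) hb.2.le
    have hcab : Real.cos b ≤ Real.cos a :=
      Real.cos_le_cos_of_nonneg_of_le_pi ha.1.le (by linarith [hb.2, Real.pi_pos]) hab
    have hca : 0 ≤ Real.cos a := hcb.trans hcab
    have key : Real.cos b * √(1 - (Real.sin a * s) ^ 2) ≤
        Real.cos a * √(1 - (Real.sin b * s) ^ 2) := by
      refine (sq_le_sq₀ (by positivity) (by positivity)).1 ?_
      rw [mul_pow _ √_, mul_pow _ √_, Real.sq_sqrt hA.le, Real.sq_sqrt hB.le, mul_pow, mul_pow,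
        Real.sin_sq, Real.sin_sq]
      have h₁ : Real.cos b ^ 2 ≤ Real.cos a ^ 2 := by gcongr
      have h₂ : 0 ≤ 1 - s ^ 2 := by nlinarith
      nlinarith [mul_nonneg h₂ (sub_nonneg.2 h₁)]
    rw [one_div_mul_eq_div, one_div_mul_eq_div,
      div_le_div_iff₀ (Real.sqrt_pos.2 hB) (Real.sqrt_pos.2 hA)]
    nlinarith [mul_le_mul_of_nonneg_left key hs₀]

/-- For `0 ≤ α ≤ π/2` and `0 ≤ β ≤ π/2`, one has `α·β ≤ (π/2)·arcsin(sin α · sin β)`. -/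
theorem mul_le_pi_div_two_mul_arcsin_sin_mul_sin (α β : ℝ)
    (hα₀ : 0 ≤ α) (hα₁ : α ≤ Real.pi / 2) (hβ₀ : 0 ≤ β) (hβ₁ : β ≤ Real.pi / 2) :
    α * β ≤ (Real.pi / 2) * Real.arcsin (Real.sin α * Real.sin β) := by
  have hpi : 0 < Real.pi / 2 := Real.pi_div_two_pos
  have h := (concaveOn_arcsin_sin_mul
    (Real.sin_nonneg_of_nonneg_of_le_pi hβ₀ (by linarith)) (Real.sin_le_one β)).2
    (Set.left_mem_Icc.2 hpi.le) (Set.right_mem_Icc.2 hpi.le)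
    (sub_nonneg.2 ((div_le_one hpi).2 hα₁)) (div_nonneg hα₀ hpi.le) (sub_add_cancel _ _)
  simp only [smul_eq_mul, mul_zero, zero_add, Real.sin_zero, zero_mul, Real.arcsin_zero,
    Real.sin_pi_div_two, one_mul, div_mul_cancel₀ α hpi.ne',
    Real.arcsin_sin (by linarith : -(Real.pi / 2) ≤ β) hβ₁] at h
  calc α * β = Real.pi / 2 * (α / (Real.pi / 2) * β) := by field_simp
    _ ≤ _ := mul_le_mul_of_nonneg_left h hpi.le
end

section
/- Let μ be a measure on the Euclidean plane ℝ² that has a density g with respect to Lebesgue measure satisfying g(z) ≤ k₃·exp(−k₄·‖z‖) for all z, where k₃ ≥ 0 and k₄ > 0 are constants. Then for any unit vectors u, v in ℝ², μ({z ∈ ℝ² : ⟨u,z⟩ ≥ 0 and ⟨v,z⟩ ≤ 0}) ≤ (k₃/k₄²)·θ(u,v). -/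
open MeasureTheory InnerProductGeometry
open scoped RealInnerProductSpace

/-- Two unit vectors of a Euclidean plane are the images of `1` and `exp (iθ)` under a linear
isometry from `ℂ`, where `θ` is the angle between them. -/
theorem exists_linearIsometryEquiv_complex {E : Type*} [NormedAddCommGroup E]
    [InnerProductSpace ℝ E] (hE : Module.finrank ℝ E = 2) {u v : E} (hu : ‖u‖ = 1)
    (hv : ‖v‖ = 1) :
    ∃ L : ℂ ≃ₗᵢ[ℝ] E, L 1 = u ∧ L (Complex.exp (angle u v * Complex.I)) = v := by
  have : FiniteDimensional ℝ E := FiniteDimensional.of_finrank_pos (by omega)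
  have horth : Orthonormal ℝ (({0} : Set (Fin 2)).domRestrict fun _ => u) :=
    ⟨fun _ => hu, fun i j hij => (hij (Subsingleton.elim i j)).elim⟩
  obtain ⟨b, hb⟩ := horth.exists_orthonormalBasis_extension_of_card_eq (by simp [hE])
  let L := Complex.isometryOfOrthonormal b
  have hL : L 1 = u := by
    simp [L, Complex.isometryOfOrthonormal_apply, hb 0 rfl]
  have hw : ‖L.symm v‖ = 1 := by simp [hv]
  have hangle : angle u v = |(L.symm v).arg| := by
    rw [← Complex.angle_one_left (by rw [← norm_pos_iff, hw]; exact one_pos),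
      ← L.toLinearIsometry.angle_map]
    simp [hL]
  have hexp : Complex.exp ((L.symm v).arg * Complex.I) = L.symm v := by
    simpa [hw] using Complex.norm_mul_exp_arg_mul_I (L.symm v)
  rcases le_total 0 (L.symm v).arg with h | h
  · refine ⟨L, hL, ?_⟩
    rw [hangle, abs_of_nonneg h, hexp, L.apply_symm_apply]
  · refine ⟨Complex.conjLIE.trans L, by simp [hL], ?_⟩
    rw [hangle, abs_of_nonpos h, LinearIsometryEquiv.trans_apply, Complex.conjLIE_apply,
      ← Complex.exp_conj]
    simp [hexp]

theorem lintegral_Ioi_mul_exp_neg_mul {k c : ℝ} (hc : 0 ≤ c) (hk : 0 < k) :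
    ∫⁻ r in Set.Ioi (0 : ℝ), ENNReal.ofReal r * ENNReal.ofReal (c * Real.exp (-k * r)) =
      ENNReal.ofReal (c / k ^ 2) := by
  have hint : ∫ r in Set.Ioi (0 : ℝ), r * Real.exp (-k * r) = 1 / k ^ 2 := by
    have := Real.integral_rpow_mul_exp_neg_mul_Ioi (a := 2) two_pos hk
    norm_num at this
    simpa using this
  have hI : IntegrableOn (fun r : ℝ => r * Real.exp (-k * r)) (Set.Ioi 0) :=
    .of_integral_ne_zero (by rw [hint]; positivity)
  calc
    _ = ∫⁻ r in Set.Ioi (0 : ℝ), ENNReal.ofReal (c * (r * Real.exp (-k * r))) :=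
      setLIntegral_congr_fun measurableSet_Ioi fun r (hr : 0 < r) => by
        rw [← ENNReal.ofReal_mul hr.le]
        congr 1
        ring
    _ = ENNReal.ofReal (∫ r in Set.Ioi (0 : ℝ), c * (r * Real.exp (-k * r))) :=
      (ofReal_integral_eq_lintegral_ofReal (hI.const_mul c)
        ((ae_restrict_iff' measurableSet_Ioi).2 <| .of_forall fun r (hr : 0 < r) => by
          change 0 ≤ _
          positivity)).symm
    _ = _ := by rw [integral_const_mul, hint, mul_one_div]

theorem volume_Ioo_inter_cos_nonneg_cos_sub_nonpos_le {θ : ℝ} (h₀ : 0 ≤ θ) :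
    volume (Set.Ioo (-Real.pi) Real.pi ∩ {φ | 0 ≤ Real.cos φ ∧ Real.cos (φ - θ) ≤ 0}) ≤
      ENNReal.ofReal θ := by
  have hsub : Set.Ioo (-Real.pi) Real.pi ∩ {φ | 0 ≤ Real.cos φ ∧ Real.cos (φ - θ) ≤ 0} ⊆
      Set.Icc (-(Real.pi / 2)) (θ - Real.pi / 2) ∪ {Real.pi / 2} := by
    rintro φ ⟨⟨h1, h2⟩, h3, h4⟩
    have h5 : -(Real.pi / 2) ≤ φ := by
      by_contra! h
      have := Real.cos_neg_of_pi_div_two_lt_of_lt (x := -φ) (by linarith) (by linarith)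
      rw [Real.cos_neg] at this
      linarith
    have h6 : φ ≤ Real.pi / 2 := by
      by_contra! h
      have := Real.cos_neg_of_pi_div_two_lt_of_lt h (by linarith)
      linarith
    by_contra! h
    simp only [Set.mem_union, Set.mem_Icc, Set.mem_singleton_iff, not_or, not_and, not_le] at h
    have h7 := h.1 h5
    have h8 := lt_of_le_of_ne h6 h.2
    have := Real.cos_pos_of_mem_Ioo (x := φ - θ) ⟨by linarith, by linarith⟩
    linarith
  refine (measure_mono hsub).trans ((measure_union_le _ _).trans ?_)
  simp

/-- Core computation in the upper bound of Lemma 1: if `μ` has a density `g` with respect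
to Lebesgue measure on the plane with `g(z) ≤ k₃·exp(−k₄·‖z‖)`, then for unit vectors
`u, v`, the wedge `{z : ⟪u,z⟫ ≥ 0, ⟪v,z⟫ ≤ 0}` has `μ`-measure at most
`(k₃/k₄²)·θ(u,v)`. -/
theorem wedge_measure_le (μ : Measure (EuclideanSpace ℝ (Fin 2)))
    (g : EuclideanSpace ℝ (Fin 2) → ℝ) (k₃ k₄ : ℝ) (hk₃ : 0 ≤ k₃) (hk₄ : 0 < k₄)
    (hμ : μ = volume.withDensity (fun z => ENNReal.ofReal (g z)))
    (hg : ∀ z, g z ≤ k₃ * Real.exp (-k₄ * ‖z‖))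
    (u v : EuclideanSpace ℝ (Fin 2)) (hu : ‖u‖ = 1) (hv : ‖v‖ = 1) :
    μ {z | 0 ≤ ⟪u, z⟫ ∧ ⟪v, z⟫ ≤ 0}
      ≤ ENNReal.ofReal ((k₃ / k₄ ^ 2) * InnerProductGeometry.angle u v) := by
  set θ := angle u v with hθ
  obtain ⟨L, rfl, hLv⟩ := exists_linearIsometryEquiv_complex (by simp) hu hv
  rw [← hθ] at hLv
  set S := {z | 0 ≤ ⟪L 1, z⟫ ∧ ⟪v, z⟫ ≤ 0} with hS
  let A : Set ℝ := Set.Ioo (-Real.pi) Real.pi ∩ {φ | 0 ≤ Real.cos φ ∧ Real.cos (φ - θ) ≤ 0}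
  have hSm : MeasurableSet S := by measurability
  have hAm : MeasurableSet A := by measurability
  let f : ℝ → ENNReal := fun r => ENNReal.ofReal (k₃ * Real.exp (-k₄ * r))
  have hf : Measurable f := by fun_prop
  have hpolar : ∀ p : ℝ × ℝ, 0 < p.1 → (L (Complex.polarCoord.symm p) ∈ S ↔
      0 ≤ Real.cos p.2 ∧ Real.cos (p.2 - θ) ≤ 0) := by
    intro p hp
    have h1 : ⟪L 1, L (Complex.polarCoord.symm p)⟫ = p.1 * Real.cos p.2 := by
      rw [L.inner_map_map, Complex.polarCoord_symm_apply]
      simp [Complex.inner, -Complex.ofReal_cos]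
    have h2 : ⟪v, L (Complex.polarCoord.symm p)⟫ = p.1 * Real.cos (p.2 - θ) := by
      rw [← hLv, L.inner_map_map, Complex.polarCoord_symm_apply, Complex.exp_mul_I, Real.cos_sub]
      simp [Complex.inner, ← Complex.ofReal_cos, ← Complex.ofReal_sin]
      ring
    rw [hS, Set.mem_ofPred_eq, h1, h2, mul_nonneg_iff_of_pos_left hp,
      ← neg_nonneg, ← mul_neg, mul_nonneg_iff_of_pos_left hp, neg_nonneg]
  calc
    μ S = ∫⁻ z in S, ENNReal.ofReal (g z) := by rw [hμ, withDensity_apply _ hSm]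
    _ ≤ ∫⁻ z in S, f ‖z‖ := lintegral_mono fun z => ENNReal.ofReal_le_ofReal (hg z)
    _ = ∫⁻ z, S.indicator (fun z => f ‖z‖) z := (lintegral_indicator hSm _).symm
    _ = ∫⁻ w, S.indicator (fun z => f ‖z‖) (L w) :=
      (L.measurePreserving.lintegral_comp
        ((hf.comp measurable_norm).indicator hSm)).symm
    _ = ∫⁻ p in polarCoord.target, ENNReal.ofReal p.1 •
          S.indicator (fun z => f ‖z‖) (L (Complex.polarCoord.symm p)) :=
      (Complex.lintegral_comp_polarCoord_symm _).symm
    _ = ∫⁻ p in polarCoord.target, (Set.Ioi 0 ×ˢ A).indicator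
          (fun p => ENNReal.ofReal p.1 * f p.1) p := by
      refine setLIntegral_congr_fun polarCoord.open_target.measurableSet fun p hp => ?_
      have hp' : 0 < p.1 ∧ p.2 ∈ Set.Ioo (-Real.pi) Real.pi := hp
      have hmem : p ∈ Set.Ioi 0 ×ˢ A ↔ L (Complex.polarCoord.symm p) ∈ S := by
        rw [hpolar p hp'.1]
        exact ⟨fun h => h.2.2, fun h => ⟨hp'.1, hp'.2, h⟩⟩
      by_cases h : L (Complex.polarCoord.symm p) ∈ S
      · simp only [Set.indicator_of_mem h, Set.indicator_of_mem (hmem.2 h), smul_eq_mul,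
          L.norm_map, Complex.norm_polarCoord_symm, abs_of_pos hp'.1]
      · simp only [Set.indicator_of_notMem h, Set.indicator_of_notMem (mt hmem.1 h), smul_zero]
    _ ≤ ∫⁻ p, (Set.Ioi 0 ×ˢ A).indicator (fun p => ENNReal.ofReal p.1 * f p.1) p :=
      setLIntegral_le_lintegral _ _
    _ = ∫⁻ p in Set.Ioi 0 ×ˢ A, ENNReal.ofReal p.1 * f p.1 * 1 := by
      simp only [mul_one]
      exact lintegral_indicator (measurableSet_Ioi.prod hAm) _
    _ = (∫⁻ r in Set.Ioi 0, ENNReal.ofReal r * f r) * volume A := by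
      rw [Measure.volume_eq_prod, ← Measure.prod_restrict,
        lintegral_prod_mul (f := fun r => ENNReal.ofReal r * f r) (g := fun _ => 1)
          (by fun_prop) (by fun_prop)]
      simp
    _ ≤ ENNReal.ofReal (k₃ / k₄ ^ 2) * ENNReal.ofReal θ := by
      rw [lintegral_Ioi_mul_exp_neg_mul hk₃ hk₄]
      gcongr
      exact volume_Ioo_inter_cos_nonneg_cos_sub_nonpos_le (angle_nonneg _ _)
    _ = ENNReal.ofReal (k₃ / k₄ ^ 2 * θ) := (ENNReal.ofReal_mul (by positivity)).symm
end

section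
/- Let μ be a probability measure on Euclidean space ℝⁿ, let u, v be linearly independent unit vectors in ℝⁿ, and let e₁, e₂ be orthonormal vectors with u, v ∈ span{e₁, e₂}. Suppose the pushforward of μ under the map x ↦ (⟨e₁,x⟩, ⟨e₂,x⟩) ∈ ℝ² has a density g with respect to Lebesgue measure on ℝ² satisfying g(z) ≤ k₃·exp(−k₄·‖z‖) for all z, where k₃ ≥ 0 and k₄ > 0. Then μ({x ∈ ℝⁿ : (⟨u,x⟩ ≥ 0 and ⟨v,x⟩ ≤ 0) or (⟨u,x⟩ ≤ 0 and ⟨v,x⟩ ≥ 0)}) ≤ (2·k₃/k₄²)·θ(u,v). -/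
open MeasureTheory InnerProductGeometry
open scoped RealInnerProductSpace

/-- The two opposite sectors of angles `φ ∈ (-π, π)` where `sin φ` and `sin (φ + θ)` have opposite
signs, for `θ > 0`. -/
theorem mem_sectors_of_sin_signs {θ φ : ℝ} (hθ₀ : 0 < θ)
    (hφ : φ ∈ Set.Ioo (-Real.pi) Real.pi)
    (h : (0 ≤ Real.sin φ ∧ Real.sin (φ + θ) ≤ 0) ∨ (Real.sin φ ≤ 0 ∧ 0 ≤ Real.sin (φ + θ))) :
    φ ∈ Set.Icc (Real.pi - θ) Real.pi ∪ Set.Icc (-θ) 0 := by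
  obtain ⟨hl, hr⟩ := hφ
  rcases h with ⟨h₁, h₂⟩ | ⟨h₁, h₂⟩
  · left
    have hφ₀ : 0 ≤ φ := by
      by_contra! hneg
      exact absurd (Real.sin_neg_of_neg_of_neg_pi_lt hneg hl) (not_lt.mpr h₁)
    refine ⟨?_, hr.le⟩
    by_contra! hlt
    exact absurd (Real.sin_pos_of_pos_of_lt_pi (by linarith) (by linarith)) (not_lt.mpr h₂)
  · right
    refine ⟨?_, ?_⟩
    · by_contra! hlt
      exact absurd (Real.sin_neg_of_neg_of_neg_pi_lt (x := φ + θ) (by linarith) (by linarith))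
        (not_lt.mpr h₂)
    · by_contra! hpos
      exact absurd (Real.sin_pos_of_pos_of_lt_pi hpos hr) (not_lt.mpr h₁)

theorem lintegral_Ioi_mul_const_mul_exp_neg (c : ℝ) (hc : 0 ≤ c) {k : ℝ} (hk : 0 < k) :
    ∫⁻ r in Set.Ioi (0 : ℝ), ENNReal.ofReal (r * (c * Real.exp (-k * r)))
      = ENNReal.ofReal (c / k ^ 2) := by
  have hint : IntegrableOn (fun r : ℝ => r * Real.exp (-k * r)) (Set.Ioi 0) := by
    simpa using integrableOn_rpow_mul_exp_neg_mul_rpow (s := 1) (p := 1) (b := k)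
      (by norm_num) one_pos hk
  have hval : ∫ r in Set.Ioi (0 : ℝ), r * Real.exp (-k * r) = 1 / k ^ 2 := by
    have h := Real.integral_rpow_mul_exp_neg_mul_Ioi (a := 2) two_pos hk
    norm_num at h
    simpa using h
  have hcomm : (fun r : ℝ => r * (c * Real.exp (-k * r)))
      = fun r => c * (r * Real.exp (-k * r)) := by
    funext r; ring
  rw [← ofReal_integral_eq_lintegral_ofReal, hcomm, integral_const_mul, hval, mul_one_div]
  · rw [hcomm]
    exact hint.const_mul c
  · filter_upwards [ae_restrict_mem measurableSet_Ioi] with r hr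
    exact mul_nonneg (le_of_lt hr) (by positivity)

/-- In the plane `ℂ`, the double sector of points `z = r exp (i φ)` where `r sin φ` and
`r sin (φ + θ)` have opposite signs carries at most the integral `(2 c / k ^ 2) θ` of the
density `c exp (-k ‖z‖)`. -/
theorem setLIntegral_double_sector_le {θ c k : ℝ} (hθ₀ : 0 < θ)
    (hc : 0 ≤ c) (hk : 0 < k) {D : Set ℂ} (hD : MeasurableSet D)
    (hsub : ∀ z ∈ D, (0 ≤ z.im ∧ Real.sin θ * z.re + Real.cos θ * z.im ≤ 0) ∨
      (z.im ≤ 0 ∧ 0 ≤ Real.sin θ * z.re + Real.cos θ * z.im)) :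
    ∫⁻ z in D, ENNReal.ofReal (c * Real.exp (-k * ‖z‖))
      ≤ ENNReal.ofReal ((2 * c / k ^ 2) * θ) := by
  set S : Set ℝ := Set.Icc (Real.pi - θ) Real.pi ∪ Set.Icc (-θ) 0 with hS
  have hSm : MeasurableSet S := measurableSet_Icc.union measurableSet_Icc
  rw [← lintegral_indicator hD, ← Complex.lintegral_comp_polarCoord_symm]
  have htarget : polarCoord.target = Set.Ioi (0 : ℝ) ×ˢ Set.Ioo (-Real.pi) Real.pi := rfl
  have hpoint : ∀ p ∈ polarCoord.target,
      ENNReal.ofReal p.1 • D.indicator (fun z : ℂ => ENNReal.ofReal (c * Real.exp (-k * ‖z‖)))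
        (Complex.polarCoord.symm p)
      ≤ ENNReal.ofReal (p.1 * (c * Real.exp (-k * p.1))) * S.indicator 1 p.2 := by
    rintro ⟨r, φ⟩ hp
    rw [htarget] at hp
    obtain ⟨hr, hφ⟩ := hp
    replace hr : 0 < r := hr
    by_cases hz : Complex.polarCoord.symm (r, φ) ∈ D
    · have hφS : φ ∈ S := by
        refine mem_sectors_of_sin_signs hθ₀ hφ ?_
        have him : (Complex.polarCoord.symm (r, φ)).im = r * Real.sin φ := by
          simp [-Complex.ofReal_cos, -Complex.ofReal_sin]
        have hre : (Complex.polarCoord.symm (r, φ)).re = r * Real.cos φ := by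
          simp [-Complex.ofReal_cos, -Complex.ofReal_sin]
        have hsum : Real.sin θ * (r * Real.cos φ) + Real.cos θ * (r * Real.sin φ)
            = r * Real.sin (φ + θ) := by
          rw [Real.sin_add]; ring
        have h := hsub _ hz
        rw [him, hre, hsum] at h
        simpa only [mul_nonneg_iff_of_pos_left hr, ← neg_nonneg (a := r * _), ← mul_neg,
          neg_nonneg] using h
      rw [Set.indicator_of_mem hz, Set.indicator_of_mem hφS, Complex.norm_polarCoord_symm,
        abs_of_pos hr, smul_eq_mul, ← ENNReal.ofReal_mul hr.le, Pi.one_apply, mul_one]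
    · rw [Set.indicator_of_notMem hz, smul_zero]
      exact zero_le
  calc _ ≤ ∫⁻ p in polarCoord.target,
        ENNReal.ofReal (p.1 * (c * Real.exp (-k * p.1))) * S.indicator 1 p.2 :=
        setLIntegral_mono' polarCoord.open_target.measurableSet hpoint
    _ = ENNReal.ofReal (c / k ^ 2)
          * ∫⁻ φ in Set.Ioo (-Real.pi) Real.pi, S.indicator 1 φ := by
        rw [htarget, Measure.volume_eq_prod, ← Measure.prod_restrict,
          lintegral_prod_mul (f := fun r => ENNReal.ofReal (r * (c * Real.exp (-k * r))))
            (by fun_prop) (measurable_one.indicator hSm).aemeasurable,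
          lintegral_Ioi_mul_const_mul_exp_neg c hc hk]
    _ ≤ ENNReal.ofReal (c / k ^ 2) * ENNReal.ofReal (2 * θ) := by
        gcongr
        calc _ ≤ ∫⁻ φ, S.indicator 1 φ := setLIntegral_le_lintegral _ _
          _ = volume S := lintegral_indicator_one hSm
          _ ≤ volume (Set.Icc (Real.pi - θ) Real.pi) + volume (Set.Icc (-θ) 0) :=
            measure_union_le _ _
          _ = ENNReal.ofReal (2 * θ) := by
            rw [Real.volume_Icc, Real.volume_Icc, ← ENNReal.ofReal_add] <;>
              first | linarith | (congr 1; ring)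
    _ = ENNReal.ofReal ((2 * c / k ^ 2) * θ) := by
        rw [← ENNReal.ofReal_mul (by positivity)]
        congr 1
        ring

theorem measurableSet_disagreement {E : Type*} [NormedAddCommGroup E] [InnerProductSpace ℝ E]
    [MeasurableSpace E] [OpensMeasurableSpace E] (a b : E) :
    MeasurableSet {z : E | (0 ≤ ⟪a, z⟫ ∧ ⟪b, z⟫ ≤ 0) ∨ (⟪a, z⟫ ≤ 0 ∧ 0 ≤ ⟪b, z⟫)} := by
  have hcont (c : E) : Continuous fun z : E => ⟪c, z⟫ := continuous_const.inner continuous_id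
  have hnonneg (c : E) : MeasurableSet {z : E | 0 ≤ ⟪c, z⟫} :=
    (isClosed_le continuous_const (hcont c)).measurableSet
  have hnonpos (c : E) : MeasurableSet {z : E | ⟪c, z⟫ ≤ 0} :=
    (isClosed_le (hcont c) continuous_const).measurableSet
  exact ((hnonneg a).inter (hnonpos b)).union ((hnonpos a).inter (hnonneg b))

theorem setLIntegral_disagreement_le {E : Type*} [NormedAddCommGroup E] [InnerProductSpace ℝ E]
    [FiniteDimensional ℝ E] [MeasurableSpace E] [BorelSpace E] (hE : Module.finrank ℝ E = 2)
    {a b : E} (ha : ‖a‖ = 1) (hb : ‖b‖ = 1) (hsin : Real.sin (angle a b) ≠ 0)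
    {c k : ℝ} (hc : 0 ≤ c) (hk : 0 < k) :
    ∫⁻ z in {z : E | (0 ≤ ⟪a, z⟫ ∧ ⟪b, z⟫ ≤ 0) ∨ (⟪a, z⟫ ≤ 0 ∧ 0 ≤ ⟪b, z⟫)},
        ENNReal.ofReal (c * Real.exp (-k * ‖z‖))
      ≤ ENNReal.ofReal ((2 * c / k ^ 2) * angle a b) := by
  set θ := angle a b with hθ
  have hθ₀ : 0 < θ := (angle_nonneg a b).lt_of_ne' fun h => hsin (by rw [hθ, h, Real.sin_zero])
  have hab : ⟪a, b⟫ = Real.cos θ := by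
    rw [hθ, cos_angle, ha, hb]; simp
  have haa : ⟪a, a⟫ = 1 := by rw [real_inner_self_eq_norm_sq, ha]; norm_num
  have hbb : ⟪b, b⟫ = 1 := by rw [real_inner_self_eq_norm_sq, hb]; norm_num
  set w : E := (Real.sin θ)⁻¹ • (b - Real.cos θ • a) with hw
  have hbw : b = Real.sin θ • w + Real.cos θ • a := by
    rw [hw, smul_smul, mul_inv_cancel₀ hsin, one_smul, sub_add_cancel]
  have hwa : ⟪w, a⟫ = 0 := by
    rw [hw, inner_smul_left, inner_sub_left, inner_smul_left, real_inner_comm, hab, haa]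
    simp
  have hww : ‖w‖ = 1 := by
    have h : Real.sin θ ^ 2 * (⟪w, w⟫ - 1) = 0 := by
      have h₁ := hbb
      rw [hbw] at h₁
      simp only [inner_add_left, inner_add_right, inner_smul_left, inner_smul_right, hwa,
        real_inner_comm w a, haa] at h₁
      simp only [conj_trivial] at h₁
      linear_combination h₁ - Real.sin_sq_add_cos_sq θ
    have h₂ : ⟪w, w⟫ = 1 := by
      have := (mul_eq_zero.mp h).resolve_left (pow_ne_zero 2 hsin)
      linarith
    rw [real_inner_self_eq_norm_sq] at h₂
    exact (pow_eq_one_iff_of_nonneg (norm_nonneg w) two_ne_zero).mp h₂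
  clear_value w
  have hon : Orthonormal ℝ ![w, a] := by
    simp [orthonormal_vecCons_iff, hww, ha, hwa]
  have hcard : Fintype.card (Fin 2) = Module.finrank ℝ E := by rw [hE, Fintype.card_fin]
  have hsp : ⊤ ≤ Submodule.span ℝ (Set.range ![w, a]) := by
    rw [← coe_basisOfOrthonormalOfCardEqFinrank hon hcard, Module.Basis.span_eq]
  set Φ := Complex.isometryOfOrthonormal (OrthonormalBasis.mk hon hsp) with hΦ
  have hΦz (z : ℂ) : Φ z = z.re • w + z.im • a := by
    rw [hΦ, Complex.isometryOfOrthonormal_apply, OrthonormalBasis.coe_mk]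
    simp
  have haΦ (z : ℂ) : ⟪a, Φ z⟫ = z.im := by
    rw [hΦz, inner_add_right, inner_smul_right, inner_smul_right, real_inner_comm, hwa, haa]
    simp
  have hbΦ (z : ℂ) : ⟪b, Φ z⟫ = Real.sin θ * z.re + Real.cos θ * z.im := by
    have hwΦ : ⟪w, Φ z⟫ = z.re := by
      rw [hΦz, inner_add_right, inner_smul_right, inner_smul_right, hwa,
        real_inner_self_eq_norm_sq, hww]
      simp
    rw [hbw, inner_add_left, inner_smul_left, inner_smul_left, hwΦ, haΦ]
    simp
  rw [← Φ.measurePreserving.setLIntegral_comp_preimage_emb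
    Φ.toHomeomorph.measurableEmbedding]
  simp only [LinearIsometryEquiv.norm_map]
  refine setLIntegral_double_sector_le hθ₀ hc hk
    (Φ.continuous.measurable (measurableSet_disagreement a b)) fun z hz => ?_
  simpa only [Set.preimage_ofPred_eq, Set.mem_ofPred_eq, haΦ, hbΦ] using hz

theorem sin_angle_ne_zero_of_linearIndependent {E : Type*} [NormedAddCommGroup E]
    [InnerProductSpace ℝ E] {u v : E} (h : LinearIndependent ℝ ![u, v]) :
    Real.sin (angle u v) ≠ 0 := by
  rw [LinearIndependent.pair_iff] at h
  rw [ne_eq, sin_eq_zero_iff_angle_eq_zero_or_angle_eq_pi, angle_eq_zero_iff, angle_eq_pi_iff]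
  rintro (⟨-, r, -, rfl⟩ | ⟨-, r, -, rfl⟩) <;>
    exact one_ne_zero (neg_eq_zero.mp (h r (-1) (by simp)).2)

/-- Upper bound of Lemma 1: if the two-dimensional marginal of the probability measure `μ`
on the plane spanned by the orthonormal vectors `e₁, e₂` (containing the linearly
independent unit vectors `u, v`) has a density `g ≤ k₃·exp(−k₄·‖z‖)` with respect to
Lebesgue measure on `ℝ²`, then the disagreement region of the homogeneous linear
classifiers with normals `u` and `v` has `μ`-measure at most `(2k₃/k₄²)·θ(u,v)`. -/
theorem disagreement_measure_le {n : ℕ} (μ : Measure (EuclideanSpace ℝ (Fin n)))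
    [IsProbabilityMeasure μ]
    (u v e₁ e₂ : EuclideanSpace ℝ (Fin n))
    (hu : ‖u‖ = 1) (hv : ‖v‖ = 1) (huv : LinearIndependent ℝ ![u, v])
    (he₁ : ‖e₁‖ = 1) (he₂ : ‖e₂‖ = 1) (he₁₂ : ⟪e₁, e₂⟫ = 0)
    (huspan : u ∈ Submodule.span ℝ {e₁, e₂}) (hvspan : v ∈ Submodule.span ℝ {e₁, e₂})
    (g : EuclideanSpace ℝ (Fin 2) → ℝ) (k₃ k₄ : ℝ) (hk₃ : 0 ≤ k₃) (hk₄ : 0 < k₄)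
    (hmap : μ.map (fun x => (WithLp.equiv 2 (Fin 2 → ℝ)).symm ![⟪e₁, x⟫, ⟪e₂, x⟫])
      = volume.withDensity (fun z => ENNReal.ofReal (g z)))
    (hg : ∀ z, g z ≤ k₃ * Real.exp (-k₄ * ‖z‖)) :
    μ {x | (0 ≤ ⟪u, x⟫ ∧ ⟪v, x⟫ ≤ 0) ∨ (⟪u, x⟫ ≤ 0 ∧ 0 ≤ ⟪v, x⟫)}
      ≤ ENNReal.ofReal ((2 * k₃ / k₄ ^ 2) * InnerProductGeometry.angle u v) := by
  set T : EuclideanSpace ℝ (Fin n) → EuclideanSpace ℝ (Fin 2) :=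
    fun x => (WithLp.equiv 2 (Fin 2 → ℝ)).symm ![⟪e₁, x⟫, ⟪e₂, x⟫] with hT
  have hTm : Measurable T := by
    have : Continuous T := by
      refine (PiLp.continuous_toLp 2 _).comp (continuous_pi fun i => ?_)
      fin_cases i
      · exact continuous_const.inner continuous_id
      · exact continuous_const.inner continuous_id
    exact this.measurable
  obtain ⟨a₁, a₂, rfl⟩ := Submodule.mem_span_pair.mp huspan
  obtain ⟨b₁, b₂, rfl⟩ := Submodule.mem_span_pair.mp hvspan
  have hinner (s t : ℝ) (x : EuclideanSpace ℝ (Fin n)) :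
      ⟪s • e₁ + t • e₂, x⟫ = ⟪(!₂[s, t] : EuclideanSpace ℝ (Fin 2)), T x⟫ := by
    simp [hT, inner_add_left, inner_smul_left, PiLp.inner_apply, mul_comm]
  have hTe (s t : ℝ) : T (s • e₁ + t • e₂) = !₂[s, t] := by
    simp [hT, inner_add_right, inner_smul_right, he₁, he₂, he₁₂, real_inner_comm e₁ e₂]
  have hinner₂ (s t s' t' : ℝ) :
      ⟪(!₂[s, t] : EuclideanSpace ℝ (Fin 2)), !₂[s', t']⟫
        = ⟪s • e₁ + t • e₂, s' • e₁ + t' • e₂⟫ := by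
    rw [hinner, hTe]
  have hnorm (s t : ℝ) : ‖(!₂[s, t] : EuclideanSpace ℝ (Fin 2))‖ = ‖s • e₁ + t • e₂‖ := by
    rw [norm_eq_sqrt_real_inner, hinner₂, ← norm_eq_sqrt_real_inner]
  set a : EuclideanSpace ℝ (Fin 2) := !₂[a₁, a₂] with ha
  set b : EuclideanSpace ℝ (Fin 2) := !₂[b₁, b₂] with hb
  have hangle : angle (a₁ • e₁ + a₂ • e₂) (b₁ • e₁ + b₂ • e₂) = angle a b := by
    rw [angle, angle, ha, hb, hinner₂, hnorm, hnorm]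
  set D : Set (EuclideanSpace ℝ (Fin 2)) :=
    {z | (0 ≤ ⟪a, z⟫ ∧ ⟪b, z⟫ ≤ 0) ∨ (⟪a, z⟫ ≤ 0 ∧ 0 ≤ ⟪b, z⟫)} with hD
  have hDm : MeasurableSet D := measurableSet_disagreement a b
  have hpre : {x | (0 ≤ ⟪a₁ • e₁ + a₂ • e₂, x⟫ ∧ ⟪b₁ • e₁ + b₂ • e₂, x⟫ ≤ 0) ∨
      (⟪a₁ • e₁ + a₂ • e₂, x⟫ ≤ 0 ∧ 0 ≤ ⟪b₁ • e₁ + b₂ • e₂, x⟫)} = T ⁻¹' D := by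
    simp only [hinner, hD, Set.preimage_ofPred_eq, ha, hb]
  rw [hpre, ← Measure.map_apply hTm hDm, hmap, withDensity_apply _ hDm, hangle]
  calc ∫⁻ z in D, ENNReal.ofReal (g z)
      ≤ ∫⁻ z in D, ENNReal.ofReal (k₃ * Real.exp (-k₄ * ‖z‖)) :=
        lintegral_mono fun z => ENNReal.ofReal_le_ofReal (hg z)
    _ ≤ ENNReal.ofReal ((2 * k₃ / k₄ ^ 2) * angle a b) :=
        setLIntegral_disagreement_le finrank_euclideanSpace_fin ((hnorm _ _).trans hu)
          ((hnorm _ _).trans hv)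
          (hangle ▸ sin_angle_ne_zero_of_linearIndependent huv) hk₃ hk₄
end

section
/- Let the family M = {m_j} of subsets of {1, …, n} and the finite set TS = {T_r} of subsets of {1, …, n} satisfy the c-anchor-set assumption at sparsity level k, with relevant sets R_r and anchor sets y_j. For each set y ⊆ {1, …, n} contained in at least one member of TS, define m̃_y := ⋂{T ∈ TS : y ⊆ T}. Then for every m_j ∈ M that belongs to R_r for at least one r: (a) m_j ⊆ m̃_{y_j}, and (b) m̃_{y_j} ⊆ T_r for every r with m_j ∈ R_r. -/
/-- Under the `c`-anchor-set assumption at sparsity level `k` (with relevant sets `R T`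
and anchor sets `y mj`), define `m̃_y := ⋂ {T ∈ TS : y ⊆ T}`. Then for every metafeature
`mj ∈ M` relevant to at least one target: (a) `mj ⊆ m̃_{y mj}` and
(b) `m̃_{y mj} ⊆ T` for every `T ∈ TS` with `mj ∈ R T`. -/
theorem anchor_set_intersection_properties {n : ℕ} (c k : ℕ)
    (M TS : Finset (Finset (Fin n)))
    (R : Finset (Fin n) → Finset (Finset (Fin n)))
    (y : Finset (Fin n) → Finset (Fin n))
    (hR : ∀ T ∈ TS, R T ⊆ M ∧ (R T).card ≤ k ∧ T = (R T).biUnion id)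
    (hy : ∀ mj ∈ M, y mj ⊆ mj ∧ (y mj).card ≤ c ∧ ∀ T ∈ TS, y mj ⊆ T → mj ∈ R T)
    (mt : Finset (Fin n) → Finset (Fin n))
    (hmt : ∀ y' : Finset (Fin n), mt y' = (TS.filter (fun T => y' ⊆ T)).inf id) :
    ∀ mj ∈ M, (∃ T ∈ TS, mj ∈ R T) →
      mj ⊆ mt (y mj) ∧ ∀ T ∈ TS, mj ∈ R T → mt (y mj) ⊆ T := by
  intro mj hmj _
  have subset_of_mem : ∀ T ∈ TS, mj ∈ R T → mj ⊆ T := by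
    intro T hT hmem
    rw [(hR T hT).2.2]
    exact Finset.subset_biUnion_of_mem id hmem
  obtain ⟨hsub, -, hanchor⟩ := hy mj hmj
  rw [hmt]
  constructor
  · refine Finset.le_inf fun T hT => ?_
    obtain ⟨hT, hyT⟩ := Finset.mem_filter.mp hT
    exact subset_of_mem T hT (hanchor T hT hyT)
  · intro T hT hmem
    exact Finset.inf_le (f := id)
      (Finset.mem_filter.mpr ⟨hT, hsub.trans (subset_of_mem T hT hmem)⟩)
end

section
/- Let TS = {T_r} be a finite set of subsets of {1, …, n} and suppose there exists a family M of subsets of {1, …, n} satisfying the c-anchor-set assumption at sparsity level k with respect to TS. For each y ⊆ {1, …, n} define m̃_y := ⋂{T ∈ TS : y ⊆ T} (when at least one T ∈ TS contains y). Then every T_r ∈ TS is the union of at most k sets from the family {m̃_y : y ⊆ {1, …, n}, |y| ≤ c} — indeed T_r = ⋃_{m_j ∈ R_r} m̃_{y_j} — and this family has at most ∑_{i=0}^{c} C(n, i) members. -/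
/-- A type with `n` elements has at most `∑_{i ≤ c} C(n,i)` subsets of size at most `c`. -/
theorem card_filter_card_le_le_sum_choose {α : Type*} [Fintype α] [DecidableEq α] (c : ℕ) :
    (Finset.univ.filter (fun s : Finset α => s.card ≤ c)).card
      ≤ ∑ i ∈ Finset.range (c + 1), (Fintype.card α).choose i := by
  have hsub : Finset.univ.filter (fun s : Finset α => s.card ≤ c) ⊆
      (Finset.range (c + 1)).biUnion (fun i => Finset.powersetCard i Finset.univ) := by
    intro s hs
    simpa [Finset.mem_powersetCard, Nat.lt_succ_iff] using hs
  refine (Finset.card_le_card hsub).trans (Finset.card_biUnion_le.trans_eq ?_)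
  simp [Finset.card_powersetCard]


/-- Item (1) of Theorem 5 (sparse Boolean autoencoding): under the `c`-anchor-set
assumption at sparsity level `k`, with `m̃_y := ⋂ {T ∈ TS : y ⊆ T}`, every target
`T ∈ TS` is the union `T = ⋃_{mj ∈ R T} m̃_{y mj}` of at most `k` sets, each belonging
to the family `{m̃_y : |y| ≤ c}`, and that family has at most `∑_{i=0}^{c} C(n,i)`
members. -/
theorem sparse_autoencoder_item_one {n : ℕ} (c k : ℕ)
    (M TS : Finset (Finset (Fin n)))
    (R : Finset (Fin n) → Finset (Finset (Fin n)))
    (y : Finset (Fin n) → Finset (Fin n))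
    (hR : ∀ T ∈ TS, R T ⊆ M ∧ (R T).card ≤ k ∧ T = (R T).biUnion id)
    (hy : ∀ mj ∈ M, y mj ⊆ mj ∧ (y mj).card ≤ c ∧ ∀ T ∈ TS, y mj ⊆ T → mj ∈ R T)
    (mt : Finset (Fin n) → Finset (Fin n))
    (hmt : ∀ y' : Finset (Fin n), mt y' = (TS.filter (fun T => y' ⊆ T)).inf id) :
    (∀ T ∈ TS,
      T = (R T).biUnion (fun mj => mt (y mj)) ∧
      ((R T).image (fun mj => mt (y mj))).card ≤ k ∧
      ∀ mj ∈ R T, mt (y mj) ∈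
        ((Finset.univ.filter (fun s : Finset (Fin n) => s.card ≤ c)).image mt)) ∧
    ((Finset.univ.filter (fun s : Finset (Fin n) => s.card ≤ c)).image mt).card
      ≤ ∑ i ∈ Finset.range (c + 1), n.choose i := by
  have hsub : ∀ T ∈ TS, ∀ mj ∈ R T, mj ⊆ T := by
    intro T hT mj hmj
    rw [(hR T hT).2.2]
    exact Finset.subset_biUnion_of_mem id hmj
  have hle : ∀ mj ∈ M, mj ⊆ mt (y mj) := by
    intro mj hmj
    rw [hmt]
    refine Finset.le_inf fun T hT => ?_
    obtain ⟨hT, hyT⟩ := Finset.mem_filter.mp hT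
    exact hsub T hT mj ((hy mj hmj).2.2 T hT hyT)
  refine ⟨fun T hT => ?_, ?_⟩
  · obtain ⟨hRM, hcard, hunion⟩ := hR T hT
    refine ⟨Finset.Subset.antisymm ?_ ?_, Finset.card_image_le.trans hcard, fun mj hmj => ?_⟩
    · conv_lhs => rw [hunion]
      exact Finset.biUnion_mono fun mj hmj => hle mj (hRM hmj)
    · refine Finset.biUnion_subset.mpr fun mj hmj => ?_
      rw [hmt]
      exact Finset.inf_le (f := id) (Finset.mem_filter.mpr
        ⟨hT, (hy mj (hRM hmj)).1.trans (hsub T hT mj hmj)⟩)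
    · exact Finset.mem_image_of_mem mt
        (Finset.mem_filter.mpr ⟨Finset.mem_univ _, (hy mj (hRM hmj)).2.1⟩)
  · refine Finset.card_image_le.trans ?_
    simpa using card_filter_card_le_le_sum_choose (α := Fin n) c
end
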